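/- Let (A,B,E,E') be an operator-valued infinitesimal probability space and let A_1,…,A_m be unital subalgebras of A each containing B. Then the following are equivalent: (1) A_1,…,A_m are infinitesimally Boolean independent over B with respect to (E,E'); (2) for every s ≥ 2, all indices i_1,…,i_s ∈ {1,…,m} which are not all equal, and all a_1 ∈ A_{i_1},…,a_s ∈ A_{i_s}, the mixed operator-valued Boolean cumulant and the mixed operator-valued infinitesimal Boolean cumulant vanish: β_s(a_1,…,a_s) = 0 and ∂β_s(a_1,…,a_s) = 0. -/

import Mathlib

noncomputable section

open scoped BigOperators

variable {A : Type*} [Ring A] [Algebra ℂ A]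

/-- For a composition `c` of `n` (encoding an interval partition of `{1,…,n}`),
`E_c(a₁,…,aₙ)` is the ordered product of `E` applied to the consecutive blocks. -/
def momComp (E : A → A) {n : ℕ} (c : Composition n) (a : Fin n → A) : A :=
  (List.ofFn fun i : Fin c.length =>
    E (List.ofFn fun j : Fin (c.blocksFun i) => a (c.embedding i j)).prod).prod

/-- `∂E_c(a₁,…,aₙ) = Σ_s` (the product defining `E_c` with the `s`-th factor `E`
replaced by `E'`). -/
def dmomComp (E E' : A → A) {n : ℕ} (c : Composition n) (a : Fin n → A) : A :=
  ∑ s : Fin c.length,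
    (List.ofFn fun i : Fin c.length =>
      (if i = s then E' else E)
        (List.ofFn fun j : Fin (c.blocksFun i) => a (c.embedding i j)).prod).prod

/-- The operator-valued Boolean cumulants
`β_n(a₁,…,aₙ) = Σ_{c composition of n} (−1)^{r(c)−1} E_c(a₁,…,aₙ)`. -/
def booCum (E : A → A) (n : ℕ) (a : Fin n → A) : A :=
  ∑ c : Composition n, ((-1 : ℂ) ^ (c.length - 1)) • momComp E c a

/-- The operator-valued infinitesimal Boolean cumulants
`∂β_n(a₁,…,aₙ) = Σ_{c composition of n} (−1)^{r(c)−1} ∂E_c(a₁,…,aₙ)`. -/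
def dBooCum (E E' : A → A) (n : ℕ) (a : Fin n → A) : A :=
  ∑ c : Composition n, ((-1 : ℂ) ^ (c.length - 1)) • dmomComp E E' c a

/-- `E : A → B` is a conditional expectation onto the unital subalgebra `B`. -/
def IsCondExpectation (B : Subalgebra ℂ A) (E : A →ₗ[ℂ] A) : Prop :=
  (∀ a, E a ∈ B) ∧ (∀ b ∈ B, E b = b) ∧
    ∀ a : A, ∀ b ∈ B, ∀ b' ∈ B, E (b * a * b') = b * E a * b'

/-- `E' : A → B` is an infinitesimal conditional expectation. -/
def IsInfCondExpectation (B : Subalgebra ℂ A) (E' : A →ₗ[ℂ] A) : Prop :=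
  (∀ a, E' a ∈ B) ∧ E' 1 = 0 ∧
    ∀ a : A, ∀ b ∈ B, ∀ b' ∈ B, E' (b * a * b') = b * E' a * b'

/-- The subalgebras `Asub i` are infinitesimally Boolean independent over `B` with
respect to `(E, E')`. -/
def InfBooleanIndep {I : Type*} (E E' : A →ₗ[ℂ] A) (Asub : I → Subalgebra ℂ A) : Prop :=
  ∀ n : ℕ, 0 < n → ∀ idx : Fin n → I,
    (∀ (k : Fin n) (h : k.val + 1 < n), idx k ≠ idx ⟨k.val + 1, h⟩) →
    ∀ a : Fin n → A, (∀ k, a k ∈ Asub (idx k)) →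
      E (List.ofFn a).prod = (List.ofFn fun k => E (a k)).prod ∧
      E' (List.ofFn a).prod =
        ∑ j : Fin n, (List.ofFn fun k => if k = j then E' (a k) else E (a k)).prod

/-- The Boolean cumulant of `x :: l`, computed by merging or separating the first two entries. -/
def cumFrom {α : Type*} [Monoid α] {R : Type*} [Ring R] (F : α → R) : α → List α → R
  | x, [] => F x
  | x, y :: l => cumFrom F (x * y) l - F x * cumFrom F y l

section ListRecursion

variable {α : Type*} [Monoid α] {R : Type*} [Ring R]

/-- The product of `F` over the consecutive blocks of `l` of prescribed sizes. -/
def blockProd (F : α → R) (l : List α) (ns : List ℕ) : R :=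
  ((l.splitWrtCompositionAux ns).map fun b => F b.prod).prod

theorem blockProd_nil (F : α → R) (l : List α) : blockProd F l [] = 1 := by
  simp [blockProd, List.splitWrtCompositionAux]

theorem blockProd_cons (F : α → R) (l : List α) (k : ℕ) (ns : List ℕ) :
    blockProd F l (k :: ns) = F (l.take k).prod * blockProd F (l.drop k) ns := by
  simp [blockProd, List.splitWrtCompositionAux_cons]

theorem prod_ofFn_blocks_eq_blockProd (F : α → R) {n : ℕ} (c : Composition n) (a : Fin n → α) :
    (List.ofFn fun i : Fin c.length =>
      F (List.ofFn fun j : Fin (c.blocksFun i) => a (c.embedding i j)).prod).prod =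
      blockProd F (List.ofFn a) c.blocks := by
  change _ = (((List.ofFn a).splitWrtComposition c).map fun b => F b.prod).prod
  congr 1
  refine List.ext_getElem (by simp) fun i h₁ h₂ => ?_
  simp only [List.getElem_ofFn, List.getElem_map, List.getElem_splitWrtComposition]
  have hi : i < c.length := by simpa using h₁
  have hs : c.sizeUpTo (i + 1) = c.sizeUpTo i + c.blocksFun ⟨i, hi⟩ := c.sizeUpTo_succ' ⟨i, hi⟩
  have hn := c.sizeUpTo_le (i + 1)
  congr 2
  refine List.ext_getElem (by simp; omega) fun j h₃ h₄ => ?_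
  simp only [List.getElem_ofFn, List.getElem_drop, List.getElem_take]
  congr 1

end ListRecursion

namespace Composition

/-- Prepend a block of size one. -/
def prependOne {n : ℕ} (c : Composition n) : Composition (n + 1) where
  blocks := 1 :: c.blocks
  blocks_pos := by
    intro i hi
    rcases List.mem_cons.1 hi with rfl | hi
    · exact Nat.one_pos
    · exact c.blocks_pos hi
  blocks_sum := by simp [add_comm]

/-- Enlarge the first block by one. -/
def enlargeFirst {n : ℕ} (c : Composition (n + 1)) : Composition (n + 2) where
  blocks := c.blocks.modifyHead (· + 1)
  blocks_pos := by
    have hp : ∀ i ∈ c.blocks, 0 < i := fun _ => c.blocks_pos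
    rcases h : c.blocks with _ | ⟨k, ks⟩
    · simp
    · intro i hi
      rw [h] at hp
      rcases List.mem_cons.1 hi with rfl | hi
      · exact Nat.succ_pos _
      · exact hp _ (List.mem_cons_of_mem _ hi)
  blocks_sum := by
    have hs := c.blocks_sum
    rcases h : c.blocks with _ | ⟨k, ks⟩
    · simp [h] at hs
    · simp [h] at hs ⊢
      omega

theorem exists_blocks_eq_cons {n : ℕ} (c : Composition (n + 1)) :
    ∃ k ks, c.blocks = (k + 1) :: ks := by
  have hs := c.blocks_sum
  rcases h : c.blocks with _ | ⟨k, ks⟩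
  · simp [h] at hs
  · have : 0 < k := c.blocks_pos (by simp [h])
    exact ⟨k - 1, ks, by simp; omega⟩

theorem bijective_prependOne_enlargeFirst (n : ℕ) :
    Function.Bijective (Sum.elim (prependOne (n := n + 1)) (enlargeFirst (n := n))) := by
  constructor
  · rintro (c | c) (d | d) h
    · have h' : (1 :: c.blocks) = 1 :: d.blocks := congrArg blocks h
      exact congrArg Sum.inl (Composition.ext (by simpa using h'))
    · have h' : (1 :: c.blocks) = d.blocks.modifyHead (· + 1) := congrArg blocks h
      obtain ⟨k, ks, hk⟩ := d.exists_blocks_eq_cons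
      simp [hk] at h'
    · have h' : c.blocks.modifyHead (· + 1) = 1 :: d.blocks := congrArg blocks h
      obtain ⟨k, ks, hk⟩ := c.exists_blocks_eq_cons
      simp [hk] at h'
    · have h' : c.blocks.modifyHead (· + 1) = d.blocks.modifyHead (· + 1) := congrArg blocks h
      obtain ⟨k, ks, hk⟩ := c.exists_blocks_eq_cons
      obtain ⟨k', ks', hk'⟩ := d.exists_blocks_eq_cons
      refine congrArg Sum.inr (Composition.ext ?_)
      simp [hk, hk'] at h' ⊢
      exact h'
  · intro c
    obtain ⟨k, ks, hk⟩ := c.exists_blocks_eq_cons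
    have hs := c.blocks_sum
    have hp : ∀ {i}, i ∈ ks → 0 < i := fun {i} hi => c.blocks_pos (by simp [hk, hi])
    rw [hk, List.sum_cons] at hs
    cases k with
    | zero =>
      exact ⟨Sum.inl ⟨ks, hp, by omega⟩, Composition.ext (by simp [prependOne, hk])⟩
    | succ k =>
      refine ⟨Sum.inr ⟨(k + 1) :: ks, ?_, by rw [List.sum_cons]; omega⟩,
        Composition.ext (by simp [enlargeFirst, hk])⟩
      intro i hi
      rcases List.mem_cons.1 hi with rfl | hi
      · exact Nat.succ_pos _
      · exact hp hi

end Composition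

section Cumulants

variable {α : Type*} [Monoid α] {R : Type*} [Ring R] [Algebra ℂ R]

theorem sum_blockProd_eq_cumFrom (F : α → R) (x : α) (l : List α) :
    ∑ c : Composition (l.length + 1), ((-1 : ℂ) ^ (c.length - 1)) • blockProd F (x :: l) c.blocks =
      cumFrom F x l := by
  induction l generalizing x with
  | nil =>
    have : Fintype.card (Composition 1) = 1 := by simp [composition_card]
    obtain ⟨c, hc⟩ := Fintype.card_eq_one_iff.1 this
    have hs : (Finset.univ : Finset (Composition (([] : List α).length + 1))) =
        {Composition.ones 1} :=
      Finset.eq_singleton_iff_unique_mem.2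
        ⟨Finset.mem_univ _, fun d _ => (hc d).trans (hc _).symm⟩
    rw [hs, Finset.sum_singleton]
    simp [blockProd_cons, blockProd_nil, cumFrom]
  | cons y l ih =>
    rw [cumFrom, ← ih, ← ih]
    refine ((Composition.bijective_prependOne_enlargeFirst l.length).sum_comp fun c =>
      ((-1 : ℂ) ^ (c.length - 1)) • blockProd F (x :: y :: l) c.blocks).symm.trans ?_
    rw [Fintype.sum_sum_type, Finset.mul_sum, ← Finset.sum_sub_distrib, ← Finset.sum_add_distrib]
    refine Finset.sum_congr rfl fun c _ => ?_
    obtain ⟨k, ks, hk⟩ := c.exists_blocks_eq_cons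
    simp only [Sum.elim_inl, Sum.elim_inr, Composition.length, Composition.prependOne,
      Composition.enlargeFirst, hk, List.modifyHead_cons, List.length_cons, blockProd_cons,
      List.take_succ_cons, List.drop_succ_cons, List.prod_cons, List.take_zero, List.drop_zero,
      List.prod_nil, mul_one, Nat.add_sub_cancel, pow_succ, mul_assoc, mul_smul_comm]
    simp [sub_eq_add_neg, add_comm]

theorem sum_prod_ofFn_blocks_eq_cumFrom (F : α → R) {n : ℕ} (a : Fin n → α) {x : α} {l : List α}
    (h : List.ofFn a = x :: l) :
    ∑ c : Composition n, ((-1 : ℂ) ^ (c.length - 1)) • (List.ofFn fun i : Fin c.length =>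
      F (List.ofFn fun j : Fin (c.blocksFun i) => a (c.embedding i j)).prod).prod =
      cumFrom F x l := by
  obtain rfl : n = l.length + 1 := by simpa using congrArg List.length h
  simp_rw [prod_ofFn_blocks_eq_blockProd, h, sum_blockProd_eq_cumFrom]

end Cumulants

section VanishingCumulants

variable {α : Type*} [Monoid α] {R : Type*} [Ring R] {ι : Type*}

theorem cumFrom_append_singleton (F : α → R) (f : ι → α) (z : α) (l : List ι)
    (h : ∀ y t, y :: t <:+ l → cumFrom F (f y) (t.map f ++ [z]) = 0) (x : α) :
    cumFrom F x (l.map f ++ [z]) =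
      F (x * (l.map f).prod * z) - F (x * (l.map f).prod) * F z := by
  induction l generalizing x with
  | nil => simp [cumFrom]
  | cons y l ih =>
    rw [List.map_cons, List.cons_append, cumFrom, h y l List.suffix_rfl,
      ih fun y' t ht => h y' t (ht.trans (List.suffix_cons _ _))]
    simp [mul_assoc]

variable {I : Type*} {F : α → R} {S : I → Set α}

theorem map_prod_of_cumFrom_eq_zero
    (h : ∀ (p : I × α) (L : List (I × α)), (∃ q ∈ L, p.1 ≠ q.1) →
      (∀ q ∈ p :: L, q.2 ∈ S q.1) → cumFrom F p.2 (L.map Prod.snd) = 0)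
    (L : List (I × α)) (hne : L ≠ []) (hL : L.IsChain fun p q => p.1 ≠ q.1)
    (hS : ∀ q ∈ L, q.2 ∈ S q.1) :
    F (L.map Prod.snd).prod = (L.map fun q => F q.2).prod := by
  have mixed : ∀ (y z : I × α) (t : List (I × α)),
      (y :: (t ++ [z])).IsChain (fun p q => p.1 ≠ q.1) → (∀ q ∈ y :: (t ++ [z]), q.2 ∈ S q.1) →
      cumFrom F y.2 (t.map Prod.snd ++ [z.2]) = 0 := by
    intro y z t hc hm
    have := h y (t ++ [z]) (by
      cases t with
      | nil => exact ⟨z, by simp, by simpa using hc⟩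
      | cons w t => exact ⟨w, by simp, (List.isChain_cons_cons.1 hc).1⟩) hm
    simpa using this
  induction L using List.reverseRecOn with
  | nil => exact absurd rfl hne
  | append_singleton M z ih =>
    cases M with
    | nil => simp
    | cons p M =>
      have ih := ih (by simp) hL.left_of_append fun q hq => hS q (List.mem_append_left _ hq)
      have key := cumFrom_append_singleton F Prod.snd z.2 M (fun y t ht => by
        have hs : y :: (t ++ [z]) <:+ p :: M ++ [z] := by
          obtain ⟨u, rfl⟩ := ht
          exact ⟨p :: u, by simp⟩
        exact mixed y z t (hL.suffix hs) fun q hq => hS q (hs.subset hq)) p.2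
      rw [mixed p z M hL hS, eq_comm, sub_eq_zero] at key
      simp only [List.map_cons, List.map_append, List.map_nil, List.prod_append, List.prod_cons,
        List.prod_nil, mul_one] at ih key ⊢
      rw [key, ih]

theorem exists_isChain_prod_eq [Nontrivial I] (hS1 : ∀ i, 1 ∈ S i) (hF1 : F 1 = 1)
    (L : List (I × α)) (hS : ∀ q ∈ L, q.2 ∈ S q.1) (i : I) :
    ∃ (x : α) (M : List (I × α)), ((i, x) :: M).IsChain (fun p q => p.1 ≠ q.1) ∧
      (∀ q ∈ (i, x) :: M, q.2 ∈ S q.1) ∧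
      (((i, x) :: M).map Prod.snd).prod = (L.map Prod.snd).prod ∧
      (((i, x) :: M).map fun q => F q.2).prod = (L.map fun q => F q.2).prod := by
  induction L generalizing i with
  | nil => exact ⟨1, [], by simp, by simp [hS1], by simp, by simp [hF1]⟩
  | cons p L ih =>
    obtain ⟨j, hj⟩ := exists_ne p.1
    obtain ⟨x, M, hc, hm, hp, hFp⟩ := ih (fun q hq => hS q (List.mem_cons_of_mem _ hq)) j
    have hpS := hS p (by simp)
    by_cases hi : i = p.1
    · subst hi
      refine ⟨p.2, (j, x) :: M, List.isChain_cons_cons.2 ⟨hj.symm, hc⟩, ?_, ?_, ?_⟩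
      · exact List.forall_mem_cons.2 ⟨hpS, hm⟩
      · rw [List.map_cons, List.prod_cons, hp, List.map_cons, List.prod_cons]
      · rw [List.map_cons, List.prod_cons, hFp, List.map_cons, List.prod_cons]
    · refine ⟨1, p :: (j, x) :: M,
        List.isChain_cons_cons.2 ⟨hi, List.isChain_cons_cons.2 ⟨hj.symm, hc⟩⟩, ?_, ?_, ?_⟩
      · exact List.forall_mem_cons.2 ⟨hS1 i, List.forall_mem_cons.2 ⟨hpS, hm⟩⟩
      · rw [List.map_cons, List.prod_cons, List.map_cons, List.prod_cons, hp, List.map_cons,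
          List.prod_cons, one_mul]
      · rw [List.map_cons, List.prod_cons, List.map_cons, List.prod_cons, hFp, List.map_cons,
          List.prod_cons, hF1, one_mul]

theorem map_prod_of_map_prod_isChain [Nontrivial I] (hS1 : ∀ i, 1 ∈ S i) (hF1 : F 1 = 1)
    (h : ∀ L : List (I × α), L ≠ [] → L.IsChain (fun p q => p.1 ≠ q.1) →
      (∀ q ∈ L, q.2 ∈ S q.1) → F (L.map Prod.snd).prod = (L.map fun q => F q.2).prod)
    (L : List (I × α)) (hS : ∀ q ∈ L, q.2 ∈ S q.1) :
    F (L.map Prod.snd).prod = (L.map fun q => F q.2).prod := by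
  obtain ⟨i⟩ : Nonempty I := inferInstance
  obtain ⟨x, M, hc, hm, hp, hFp⟩ := exists_isChain_prod_eq hS1 hF1 L hS i
  rw [← hp, ← hFp]
  exact h _ (by simp) hc hm

theorem cumFrom_eq_zero_of_map_prod
    (h : ∀ L : List (I × α), (∀ q ∈ L, q.2 ∈ S q.1) →
      F (L.map Prod.snd).prod = (L.map fun q => F q.2).prod)
    (N L : List (I × α)) (hL : L ≠ []) (hNS : ∀ q ∈ N, q.2 ∈ S q.1) (hLS : ∀ q ∈ L, q.2 ∈ S q.1) :
    cumFrom F (N.map Prod.snd).prod (L.map Prod.snd) = 0 := by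
  induction L generalizing N with
  | nil => exact absurd rfl hL
  | cons y L ih =>
    obtain ⟨hy, hLS'⟩ := List.forall_mem_cons.1 hLS
    have hNy : ∀ q ∈ N ++ [y], q.2 ∈ S q.1 := fun q hq => by
      rcases List.mem_append.1 hq with hq | hq
      · exact hNS q hq
      · exact List.mem_singleton.1 hq ▸ hy
    have e : (N.map Prod.snd).prod * y.2 = ((N ++ [y]).map Prod.snd).prod := by simp
    rw [List.map_cons, cumFrom, e]
    rcases eq_or_ne L [] with rfl | hne
    · simp only [List.map_nil, cumFrom]
      rw [h _ hNy, h _ hNS]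
      simp
    · have h1 := ih (N ++ [y]) hne hNy hLS'
      have h2 := ih [y] hne (by simpa using hy) hLS'
      rw [h1, show y.2 = ([y].map Prod.snd).prod by simp, h2]
      simp

theorem map_prod_isChain_iff_cumFrom_eq_zero (hS1 : ∀ i, 1 ∈ S i) (hF1 : F 1 = 1) :
    (∀ L : List (I × α), L ≠ [] → L.IsChain (fun p q => p.1 ≠ q.1) →
      (∀ q ∈ L, q.2 ∈ S q.1) → F (L.map Prod.snd).prod = (L.map fun q => F q.2).prod) ↔
    ∀ (p : I × α) (L : List (I × α)), (∃ q ∈ L, p.1 ≠ q.1) →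
      (∀ q ∈ p :: L, q.2 ∈ S q.1) → cumFrom F p.2 (L.map Prod.snd) = 0 := by
  refine ⟨fun h p L hmix hS => ?_, map_prod_of_cumFrom_eq_zero⟩
  obtain ⟨q, hq, hne⟩ := hmix
  have : Nontrivial I := ⟨⟨_, _, hne⟩⟩
  obtain ⟨hp, hLS⟩ := List.forall_mem_cons.1 hS
  simpa using cumFrom_eq_zero_of_map_prod (map_prod_of_map_prod_isChain hS1 hF1 h) [p] L
    (List.ne_nil_of_mem hq) (by simpa using hp) hLS

end VanishingCumulants

section DualNumbers

open TrivSqZeroExt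

section

variable {S : Type*} [Ring S]

/-- The pair `(E, E')` as a single map `E + ε E'` into the dual numbers. -/
def dualExp (E E' : S → S) (a : S) : DualNumber S := inl (E a) + inr (E' a)

@[simp]
theorem fst_dualExp (E E' : S → S) (a : S) : (dualExp E E' a).fst = E a := by simp [dualExp]

@[simp]
theorem snd_dualExp (E E' : S → S) (a : S) : (dualExp E E' a).snd = E' a := by simp [dualExp]

theorem DualNumber.snd_prod_ofFn {n : ℕ} (f : Fin n → DualNumber S) :
    (List.ofFn f).prod.snd =
      ∑ s, (List.ofFn fun i => if i = s then (f i).snd else (f i).fst).prod := by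
  induction n with
  | zero => simp
  | succ n ih =>
    rw [List.ofFn_succ, List.prod_cons, DualNumber.snd_mul, ih, Fin.sum_univ_succ, add_comm,
      Finset.mul_sum, fst_list_prod, List.map_ofFn]
    congr 1
    · simp [List.ofFn_succ, Function.comp_def, Fin.succ_ne_zero]
    · refine Finset.sum_congr rfl fun s _ => ?_
      simp [List.ofFn_succ, Fin.succ_inj, (Fin.succ_ne_zero s).symm]

theorem DualNumber.fst_prod_ofFn {n : ℕ} (f : Fin n → DualNumber S) :
    (List.ofFn f).prod.fst = (List.ofFn fun i => (f i).fst).prod := by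
  rw [fst_list_prod, List.map_ofFn]
  rfl

theorem dualExp_prod_ofFn_eq_iff (E E' : S → S) {n : ℕ} (a : Fin n → S) :
    dualExp E E' (List.ofFn a).prod = (List.ofFn fun k => dualExp E E' (a k)).prod ↔
      E (List.ofFn a).prod = (List.ofFn fun k => E (a k)).prod ∧
      E' (List.ofFn a).prod =
        ∑ j : Fin n, (List.ofFn fun k => if k = j then E' (a k) else E (a k)).prod := by
  rw [TrivSqZeroExt.ext_iff, DualNumber.fst_prod_ofFn, DualNumber.snd_prod_ofFn]
  simp only [fst_dualExp, snd_dualExp]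

end

theorem fst_cumFrom_dualExp (E E' : A → A) {n : ℕ} (a : Fin n → A) {x : A} {l : List A}
    (h : List.ofFn a = x :: l) : (cumFrom (dualExp E E') x l).fst = booCum E n a := by
  rw [← sum_prod_ofFn_blocks_eq_cumFrom _ a h, fst_sum]
  simp_rw [fst_smul, DualNumber.fst_prod_ofFn, fst_dualExp]
  rfl

theorem snd_cumFrom_dualExp (E E' : A → A) {n : ℕ} (a : Fin n → A) {x : A} {l : List A}
    (h : List.ofFn a = x :: l) : (cumFrom (dualExp E E') x l).snd = dBooCum E E' n a := by
  rw [← sum_prod_ofFn_blocks_eq_cumFrom _ a h, snd_sum]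
  simp_rw [snd_smul, DualNumber.snd_prod_ofFn, fst_dualExp, snd_dualExp, dBooCum, dmomComp,
    ite_apply]

theorem infBooleanIndep_iff_dualExp {I : Type*} (E E' : A →ₗ[ℂ] A) (Asub : I → Subalgebra ℂ A) :
    InfBooleanIndep E E' Asub ↔
      ∀ L : List (I × A), L ≠ [] → L.IsChain (fun p q => p.1 ≠ q.1) →
        (∀ q ∈ L, q.2 ∈ (Asub q.1 : Set A)) →
        dualExp E E' (L.map Prod.snd).prod = (L.map fun q => dualExp E E' q.2).prod := by
  constructor
  · intro h L hne hc hS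
    have := (dualExp_prod_ofFn_eq_iff E E' fun k => (L.get k).2).2
      (h L.length (List.length_pos_of_ne_nil hne) (fun k => (L.get k).1)
        (fun k hk => List.isChain_iff_getElem.1 hc k hk) (fun k => (L.get k).2)
        fun k => hS _ (L.get_mem k))
    have e : ∀ {β : Type _} (g : I × A → β), (List.ofFn fun k => g (L.get k)) = L.map g :=
      fun g => by rw [← Function.comp_def, ← List.map_ofFn, List.ofFn_get]
    rwa [e Prod.snd, e fun q => dualExp E E' q.2] at this
  · intro h n hn idx hc a hS
    refine (dualExp_prod_ofFn_eq_iff E E' a).1 ?_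
    have := h (List.ofFn fun k => (idx k, a k)) (by simp; omega)
      (List.isChain_ofFn.2 fun i hi => hc ⟨i, by omega⟩ hi)
      (by simpa [List.forall_mem_ofFn_iff] using hS)
    simpa [List.map_ofFn, Function.comp_def] using this

theorem mixed_cumulants_eq_zero_iff_cumFrom {I : Type*} (E E' : A → A)
    (Asub : I → Subalgebra ℂ A) :
    (∀ s : ℕ, 2 ≤ s → ∀ idx : Fin s → I, (∃ k k' : Fin s, idx k ≠ idx k') →
        ∀ a : Fin s → A, (∀ k, a k ∈ Asub (idx k)) →
          booCum E s a = 0 ∧ dBooCum E E' s a = 0) ↔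
      ∀ (p : I × A) (L : List (I × A)), (∃ q ∈ L, p.1 ≠ q.1) →
        (∀ q ∈ p :: L, q.2 ∈ (Asub q.1 : Set A)) →
        cumFrom (dualExp E E') p.2 (L.map Prod.snd) = 0 := by
  constructor
  · intro h p L hmix hS
    obtain ⟨q, hq, hne⟩ := hmix
    obtain ⟨k, rfl⟩ := List.get_of_mem hq
    have e : (List.ofFn fun j => ((p :: L).get j).2) = p.2 :: L.map Prod.snd := by
      have := List.map_ofFn (f := (p :: L).get) (g := Prod.snd)
      rw [List.ofFn_get] at this
      exact this.symm
    have := h (p :: L).length (by have := k.2; simp; omega) (fun j => ((p :: L).get j).1)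
      ⟨0, k.succ, hne⟩ (fun j => ((p :: L).get j).2) fun j => hS _ (List.get_mem _ j)
    exact TrivSqZeroExt.ext ((fst_cumFrom_dualExp E E' _ e).trans this.1)
      ((snd_cumFrom_dualExp E E' _ e).trans this.2)
  · intro h s hs idx hmix a hS
    obtain ⟨s, rfl⟩ : ∃ t, s = t + 1 := ⟨s - 1, by omega⟩
    have hmix' : ∃ k : Fin s, idx 0 ≠ idx k.succ := by
      by_contra! hall
      obtain ⟨k, k', hk⟩ := hmix
      have h0 : ∀ j, idx 0 = idx j := Fin.cases rfl hall
      exact hk ((h0 k).symm.trans (h0 k'))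
    obtain ⟨k, hk⟩ := hmix'
    have e : List.ofFn a =
        a 0 :: (List.ofFn fun k : Fin s => (idx k.succ, a k.succ)).map Prod.snd := by
      rw [List.ofFn_succ, List.map_ofFn]
      rfl
    have := h (idx 0, a 0) (List.ofFn fun k : Fin s => (idx k.succ, a k.succ))
      ⟨_, List.mem_ofFn.2 ⟨k, rfl⟩, hk⟩
      (List.forall_mem_cons.2 ⟨hS 0, List.forall_mem_ofFn_iff.2 fun j => hS j.succ⟩)
    rw [← fst_cumFrom_dualExp E E' a e, ← snd_cumFrom_dualExp E E' a e, this]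
    exact ⟨rfl, rfl⟩

end DualNumbers

/-- Theorem: in an OVI probability space `(A, B, E, E')`, unital subalgebras
`A₁, …, A_m ⊇ B` are infinitesimally Boolean independent with respect to `(E, E')` iff
all mixed operator-valued Boolean cumulants and all mixed operator-valued infinitesimal
Boolean cumulants vanish. -/
theorem infBoolean_iff_vanishing_mixed_cumulants
    (B : Subalgebra ℂ A) (E E' : A →ₗ[ℂ] A)
    (hE : IsCondExpectation B E) (hE' : IsInfCondExpectation B E')
    (m : ℕ) (Asub : Fin m → Subalgebra ℂ A) (hB : ∀ i, B ≤ Asub i) :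
    InfBooleanIndep E E' Asub ↔
      ∀ s : ℕ, 2 ≤ s → ∀ idx : Fin s → Fin m, (∃ k k' : Fin s, idx k ≠ idx k') →
        ∀ a : Fin s → A, (∀ k, a k ∈ Asub (idx k)) →
          booCum ⇑E s a = 0 ∧ dBooCum ⇑E ⇑E' s a = 0 := by
  rw [infBooleanIndep_iff_dualExp, mixed_cumulants_eq_zero_iff_cumFrom]
  refine map_prod_isChain_iff_cumFrom_eq_zero (S := fun i => (Asub i : Set A))
    (fun i => (Asub i).one_mem) ?_
  exact TrivSqZeroExt.ext (by simpa using hE.2.1 1 B.one_mem) (by simpa using hE'.2.1)
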